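/- Let n be a positive integer and S a nonempty subset of Fin n, and let F_S be the permutation of n-bit strings that negates exactly the bits in positions belonging to S. Then F_S can be written as a product of exactly 2^{n−1} transpositions of n-bit strings: there exists a list of 2^{n−1} pairs (a_i, b_i) of distinct n-bit strings such that F_S = Π_{i=1}^{2^{n−1}} Equiv.swap a_i b_i. (Hence the symmetric flip of a k-dimensional image with 2^n pixels is implemented by 2^{n−1} two-point swappings.) -/

import Mathlib

theorem prod_swaps_aux {α : Type*} [DecidableEq α] (F : Equiv.Perm α) (h2 : ∀ x, F (F x) = x)
    (l : List α) (hl : l.Nodup) (hF : ∀ a ∈ l, F a ∉ l) (x : α) :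
    (l.map fun a => Equiv.swap a (F a)).prod x = if x ∈ l ∨ F x ∈ l then F x else x := by
  induction l with
  | nil => simp
  | cons a l ih =>
    have hl' := List.nodup_cons.1 hl
    have ih' := ih hl'.2 (fun b hb hb' => hF b (by simp [hb]) (by simp [hb']))
    have ha := hF a (by simp)
    simp only [List.map_cons, List.prod_cons, Equiv.Perm.mul_apply, ih']
    have hx := h2 x
    have h3 := h2 a
    simp only [Equiv.swap_apply_def]
    grind

/-- The symmetric flip permutation `F_S` of `n`-bit strings is a product of exactly
`2^(n-1)` two-point swappings. -/
theorem symmetric_flip_prod_of_swaps (n : ℕ) (hn : 0 < n)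
    (S : Finset (Fin n)) (hS : S.Nonempty)
    (F : Equiv.Perm (Fin n → Bool))
    (hF : ∀ x i, F x i = if i ∈ S then !(x i) else x i) :
    ∃ L : List ((Fin n → Bool) × (Fin n → Bool)),
      L.length = 2 ^ (n - 1) ∧ (∀ q ∈ L, q.1 ≠ q.2) ∧
      F = (L.map fun q => Equiv.swap q.1 q.2).prod := by
  obtain ⟨s, hs⟩ := hS
  have h2 : ∀ x, F (F x) = x := by
    intro x
    funext i
    rw [hF, hF]
    split_ifs <;> simp
  have hFs : ∀ x, F x s = !(x s) := fun x => by simp [hF, hs]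
  let T : Finset (Fin n → Bool) := Finset.univ.filter fun x => x s = false
  have hT : ∀ x, x ∈ T ↔ x s = false := fun x => by simp [T]
  have hcard : T.card = 2 ^ (n - 1) := by
    have h1 : Tᶜ.card = T.card := by
      rw [← Finset.card_map F.toEmbedding (s := T)]
      congr 1
      ext x
      rw [Finset.mem_map_equiv, Finset.mem_compl, hT, hT]
      have : F.symm x = F x := by rw [Equiv.symm_apply_eq, h2]
      rw [this, hFs]
      simp
    have h3 := Finset.card_add_card_compl T
    rw [h1] at h3
    simp only [Fintype.card_pi, Fintype.card_bool, Finset.prod_const, Finset.card_univ,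
      Fintype.card_fin] at h3
    obtain ⟨m, rfl⟩ : ∃ m, n = m + 1 := ⟨n - 1, by omega⟩
    rw [pow_succ] at h3
    simp only [Nat.add_sub_cancel]
    omega
  refine ⟨T.toList.map fun a => (a, F a), by simp [hcard], ?_, ?_⟩
  · intro q hq
    obtain ⟨a, -, rfl⟩ := List.mem_map.1 hq
    intro h
    have := congrFun h s
    simp [hFs] at this
  · ext1 x
    rw [List.map_map]
    have := prod_swaps_aux F h2 T.toList T.nodup_toList (by simp [hT, hFs]) x
    refine Eq.trans ?_ this.symm
    rw [if_pos]
    simp only [Finset.mem_toList, hT, hFs]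
    cases x s <;> simp
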